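/- arXiv:1410.7197 — 3 statements merged into one kernel-verified Lean document; each statement's English description precedes it below -/
import Mathlib

section
/- The optimal value γ*(G, M) of the semidefinite program satisfies ρ̂(G, M) ≤ γ*(G, M) ≤ √n · ρ̂(G, M). -/
open Filter Matrix

/-- The operator norm on `n × n` real matrices induced by the Euclidean norm on `ℝ^n`. -/
noncomputable def euclOpNorm {n : ℕ} (A : Matrix (Fin n) (Fin n) ℝ) : ℝ :=
  ‖LinearMap.toContinuousLinearMap (Matrix.toEuclideanLin A)‖

/-- The Euclidean norm on `ℝ^n`. -/
noncomputable def euclNorm {n : ℕ} (x : Fin n → ℝ) : ℝ :=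
  Real.sqrt (∑ i, x i ^ 2)

/-- The matrix product `A_{σ(t-1)} ⋯ A_{σ(0)}` associated to a sequence of labels `σ`. -/
noncomputable def pathProd {n N : ℕ} (A : Fin N → Matrix (Fin n) (Fin n) ℝ)
    (t : ℕ) (σ : Fin t → Fin N) : Matrix (Fin n) (Fin n) ℝ :=
  (List.ofFn fun i => A (σ i)).reverse.prod

/-- `v, σ` describe a path of length `t` in the labeled graph with edge set `E`:
its `i`-th edge goes from node `v i` to node `v (i+1)` and carries the label `σ i`. -/
def IsPath {V : Type*} {N : ℕ} (E : Set (V × V × Fin N)) {t : ℕ}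
    (v : Fin (t + 1) → V) (σ : Fin t → Fin N) : Prop :=
  ∀ i : Fin t, (v i.castSucc, v i.succ, σ i) ∈ E

/-- The labeled graph with edge set `E` is strongly connected: any node can be joined to
any node by a path of length at least 1. -/
def StronglyConnected {V : Type*} {N : ℕ} (E : Set (V × V × Fin N)) : Prop :=
  ∀ u w : V, ∃ (t : ℕ) (v : Fin (t + 1) → V) (σ : Fin t → Fin N),
    1 ≤ t ∧ IsPath E v σ ∧ v 0 = u ∧ v (Fin.last t) = w

/-- The constrained joint spectral radius of the system `S(G, M)` with `G = (V, E)`, `M = A`. -/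
noncomputable def cjsr {V : Type*} {n N : ℕ} (E : Set (V × V × Fin N))
    (A : Fin N → Matrix (Fin n) (Fin n) ℝ) : ℝ :=
  Filter.atTop.limsup fun t : ℕ =>
    sSup { x : ℝ | ∃ (v : Fin (t + 1) → V) (σ : Fin t → Fin N),
      IsPath E v σ ∧ x = euclOpNorm (pathProd A t σ) ^ (1 / (t : ℝ)) }

/-- The constrained joint spectral radius of the `T`-lifted system `S(G_T, M^T)`:
paths of length `k` in `G_T` are exactly paths of length `k * T` in `G`. -/
noncomputable def cjsrLift {V : Type*} {n N : ℕ} (E : Set (V × V × Fin N))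
    (A : Fin N → Matrix (Fin n) (Fin n) ℝ) (T : ℕ) : ℝ :=
  Filter.atTop.limsup fun k : ℕ =>
    sSup { x : ℝ | ∃ (v : Fin (k * T + 1) → V) (σ : Fin (k * T) → Fin N),
      IsPath E v σ ∧ x = euclOpNorm (pathProd A (k * T) σ) ^ (1 / (k : ℝ)) }

/-- Stability of the constrained switching system: along every infinite path of the graph,
every trajectory converges to `0`. -/
def Stable {V : Type*} {n N : ℕ} (E : Set (V × V × Fin N))
    (A : Fin N → Matrix (Fin n) (Fin n) ℝ) : Prop :=
  ∀ (v : ℕ → V) (σ : ℕ → Fin N), (∀ t : ℕ, (v t, v (t + 1), σ t) ∈ E) →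
    ∀ x0 : Fin n → ℝ,
      Tendsto (fun t : ℕ => (pathProd A t fun i : Fin t => σ i).mulVec x0)
        atTop (nhds 0)

/-- `ν` is a family of norms on `ℝ^n` indexed by the nodes. -/
def IsNormFamily {V : Type*} {n : ℕ} (ν : V → (Fin n → ℝ) → ℝ) : Prop :=
  ∀ u : V,
    (∀ x y : Fin n → ℝ, ν u (x + y) ≤ ν u x + ν u y) ∧
    (∀ (a : ℝ) (x : Fin n → ℝ), ν u (a • x) = |a| * ν u x) ∧
    (∀ x : Fin n → ℝ, ν u x = 0 → x = 0)

/-- `ν` is a `γ`-multinorm for the system `S(G, M)`. -/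
def IsMultinorm {V : Type*} {n N : ℕ} (E : Set (V × V × Fin N))
    (A : Fin N → Matrix (Fin n) (Fin n) ℝ) (γ : ℝ)
    (ν : V → (Fin n → ℝ) → ℝ) : Prop :=
  IsNormFamily ν ∧
    ∀ vi vj : V, ∀ σ : Fin N, (vi, vj, σ) ∈ E →
      ∀ x : Fin n → ℝ, ν vj ((A σ).mulVec x) ≤ γ * ν vi x

/-- `Q` is a quadratic `γ`-multinorm for the system `S(G, M)`. -/
def IsQuadMultinorm {V : Type*} {n N : ℕ} (E : Set (V × V × Fin N))
    (A : Fin N → Matrix (Fin n) (Fin n) ℝ) (γ : ℝ)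
    (Q : V → Matrix (Fin n) (Fin n) ℝ) : Prop :=
  (∀ u : V, (Q u).PosDef) ∧
    ∀ vi vj : V, ∀ σ : Fin N, (vi, vj, σ) ∈ E →
      (γ ^ 2 • Q vi - (A σ)ᵀ * Q vj * A σ).PosSemidef

/-- `Q` is a quadratic `γ`-multinorm for the lifted system `S(G_T, M^T)`: the Loewner
inequality holds along every path of length `T` of `G` (i.e. every edge of `G_T`). -/
def IsQuadMultinormLift {V : Type*} {n N : ℕ} (E : Set (V × V × Fin N))
    (A : Fin N → Matrix (Fin n) (Fin n) ℝ) (T : ℕ) (γ : ℝ)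
    (Q : V → Matrix (Fin n) (Fin n) ℝ) : Prop :=
  (∀ u : V, (Q u).PosDef) ∧
    ∀ (v : Fin (T + 1) → V) (σ : Fin T → Fin N), IsPath E v σ →
      (γ ^ 2 • Q (v 0) -
        (pathProd A T σ)ᵀ * Q (v (Fin.last T)) * pathProd A T σ).PosSemidef

/-- `Q` is a path-dependent Lyapunov function with memory `T` for `S(G, M)`:
one positive definite quadratic form per path of length `T`, with a strict decrease
condition along every path of length `T + 1`. -/
def IsPathDepLyap {V : Type*} {n N : ℕ} (E : Set (V × V × Fin N))
    (A : Fin N → Matrix (Fin n) (Fin n) ℝ) (T : ℕ)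
    (Q : (Fin (T + 1) → V) → (Fin T → Fin N) → Matrix (Fin n) (Fin n) ℝ) : Prop :=
  (∀ (v : Fin (T + 1) → V) (σ : Fin T → Fin N), IsPath E v σ → (Q v σ).PosDef) ∧
    ∀ (v : Fin (T + 2) → V) (σ : Fin (T + 1) → Fin N), IsPath E v σ →
      (Q (fun i : Fin (T + 1) => v i.castSucc) (fun i : Fin T => σ i.castSucc) -
        (A (σ (Fin.last T)))ᵀ *
          Q (fun i : Fin (T + 1) => v i.succ) (fun i : Fin T => σ i.succ) *
            A (σ (Fin.last T))).PosDef

/-- The joint spectral radius of a finite set of matrices (arbitrary switching). -/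
noncomputable def jsr {n N : ℕ} (A : Fin N → Matrix (Fin n) (Fin n) ℝ) : ℝ :=
  Filter.atTop.limsup fun t : ℕ =>
    sSup { x : ℝ | ∃ σ : Fin t → Fin N,
      x = euclOpNorm (pathProd A t σ) ^ (1 / (t : ℝ)) }

/-- The joint spectral radius of the set `M^T` of all products of `T` matrices from `M`:
products of `k` matrices from `M^T` are exactly products of `k * T` matrices from `M`. -/
noncomputable def jsrPow {n N : ℕ} (A : Fin N → Matrix (Fin n) (Fin n) ℝ) (T : ℕ) : ℝ :=
  Filter.atTop.limsup fun k : ℕ =>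
    sSup { x : ℝ | ∃ σ : Fin (k * T) → Fin N,
      x = euclOpNorm (pathProd A (k * T) σ) ^ (1 / (k : ℝ)) }

/-- The optimal value `γ*(G, M)` of the semidefinite program of Corollary 4.6. -/
noncomputable def gammaStar {V : Type*} {n N : ℕ} (E : Set (V × V × Fin N))
    (A : Fin N → Matrix (Fin n) (Fin n) ℝ) : ℝ :=
  sInf {γ : ℝ | 0 < γ ∧ ∃ Q : V → Matrix (Fin n) (Fin n) ℝ,
    (∀ u : V, (Q u).PosDef) ∧ ∀ vi vj : V, ∀ σ : Fin N, (vi, vj, σ) ∈ E →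
      (γ ^ 2 • Q vi - (A σ)ᵀ * Q vj * A σ).PosDef}

/-- The optimal value `γ*(G_T, M^T)` of the semidefinite program applied to the lifted
system `S(G_T, M^T)`. -/
noncomputable def gammaStarLift {V : Type*} {n N : ℕ} (E : Set (V × V × Fin N))
    (A : Fin N → Matrix (Fin n) (Fin n) ℝ) (T : ℕ) : ℝ :=
  sInf {γ : ℝ | 0 < γ ∧ ∃ Q : V → Matrix (Fin n) (Fin n) ℝ,
    (∀ u : V, (Q u).PosDef) ∧
      ∀ (v : Fin (T + 1) → V) (σ : Fin T → Fin N), IsPath E v σ →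
        (γ ^ 2 • Q (v 0) -
          (pathProd A T σ)ᵀ * Q (v (Fin.last T)) * pathProd A T σ).PosDef}

/-- Gram factorization of a real positive semidefinite matrix. -/
lemma aux_posSemidef_factor {n : ℕ} {Q : Matrix (Fin n) (Fin n) ℝ} (h : Q.PosSemidef) :
    ∃ B : Matrix (Fin n) (Fin n) ℝ, Q = Bᵀ * B := by
  open scoped MatrixOrder in
  obtain ⟨B, hB⟩ := CStarAlgebra.nonneg_iff_eq_star_mul_self.mp h.nonneg
  refine ⟨B, ?_⟩
  rw [hB, star_eq_conjTranspose, conjTranspose_eq_transpose_of_trivial]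

lemma aux_quad_gram {n : ℕ} (B Q : Matrix (Fin n) (Fin n) ℝ) (x : Fin n → ℝ) :
    x ⬝ᵥ (Bᵀ * Q * B) *ᵥ x = (B *ᵥ x) ⬝ᵥ Q *ᵥ (B *ᵥ x) := by
  rw [← mulVec_mulVec, ← mulVec_mulVec, dotProduct_mulVec, vecMul_transpose]

lemma aux_quad_gram_one {n : ℕ} (B : Matrix (Fin n) (Fin n) ℝ) (x : Fin n → ℝ) :
    x ⬝ᵥ (Bᵀ * B) *ᵥ x = (B *ᵥ x) ⬝ᵥ (B *ᵥ x) := by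
  rw [← mulVec_mulVec, dotProduct_mulVec, vecMul_transpose]

lemma aux_norm_sq {n : ℕ} (x : Fin n → ℝ) : ‖WithLp.toLp 2 x‖ ^ 2 = x ⬝ᵥ x := by
  rw [EuclideanSpace.real_norm_sq_eq]
  simp [dotProduct, sq]

lemma aux_opNorm_nonneg {n : ℕ} (P : Matrix (Fin n) (Fin n) ℝ) : 0 ≤ euclOpNorm P :=
  norm_nonneg _

lemma aux_dot_nonneg {n : ℕ} (x : Fin n → ℝ) : 0 ≤ x ⬝ᵥ x := by
  rw [← aux_norm_sq]; positivity

lemma aux_opNorm_bound {n : ℕ} (P : Matrix (Fin n) (Fin n) ℝ) (x : Fin n → ℝ) :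
    (P *ᵥ x) ⬝ᵥ (P *ᵥ x) ≤ euclOpNorm P ^ 2 * (x ⬝ᵥ x) := by
  rw [← aux_norm_sq, ← aux_norm_sq, ← mul_pow]
  refine pow_le_pow_left₀ (norm_nonneg _) ?_ 2
  exact (LinearMap.toContinuousLinearMap (Matrix.toEuclideanLin P)).le_opNorm (WithLp.toLp 2 x)

lemma aux_opNorm_le {n : ℕ} (P : Matrix (Fin n) (Fin n) ℝ) (c : ℝ) (hc : 0 ≤ c)
    (h : ∀ x : Fin n → ℝ, (P *ᵥ x) ⬝ᵥ (P *ᵥ x) ≤ c ^ 2 * (x ⬝ᵥ x)) : euclOpNorm P ≤ c := by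
  refine ContinuousLinearMap.opNorm_le_bound _ hc fun x => ?_
  have := h x.ofLp
  rw [← aux_norm_sq, ← aux_norm_sq, ← mul_pow] at this
  exact (pow_le_pow_iff_left₀ (norm_nonneg _) (by positivity) two_ne_zero).1 this

lemma aux_opNorm_mul {n : ℕ} (P R : Matrix (Fin n) (Fin n) ℝ) :
    euclOpNorm (P * R) ≤ euclOpNorm P * euclOpNorm R := by
  have hP := aux_opNorm_nonneg P
  have hR := aux_opNorm_nonneg R
  refine aux_opNorm_le _ _ (by positivity) fun x => ?_
  rw [← mulVec_mulVec, mul_pow, mul_assoc]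
  exact (aux_opNorm_bound P _).trans (mul_le_mul_of_nonneg_left (aux_opNorm_bound R x) (by positivity))

lemma aux_opNorm_one {n : ℕ} : euclOpNorm (1 : Matrix (Fin n) (Fin n) ℝ) ≤ 1 :=
  aux_opNorm_le _ _ zero_le_one fun x => by simp

/-- Frobenius bound. -/
lemma aux_frob {n : ℕ} (D : Matrix (Fin n) (Fin n) ℝ) (y : Fin n → ℝ) :
    (D *ᵥ y) ⬝ᵥ (D *ᵥ y) ≤ (Dᵀ * D).trace * (y ⬝ᵥ y) := by
  have h : (Dᵀ * D).trace = ∑ i, ∑ j, D i j ^ 2 := by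
    simp only [trace, diag_apply, mul_apply, transpose_apply]
    rw [Finset.sum_comm]
    simp [sq]
  rw [h, Finset.sum_mul]
  simp only [dotProduct, mulVec]
  refine Finset.sum_le_sum fun i _ => ?_
  have := Finset.sum_mul_sq_le_sq_mul_sq Finset.univ (fun j => D i j) y
  simpa [sq] using this

lemma aux_trace_le {n : ℕ} {Q W : Matrix (Fin n) (Fin n) ℝ} (hQ : Q.PosDef) (hW : W.PosSemidef)
    (x : Fin n → ℝ) : x ⬝ᵥ W *ᵥ x ≤ (Q⁻¹ * W).trace * (x ⬝ᵥ Q *ᵥ x) := by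
  obtain ⟨B, rfl⟩ := aux_posSemidef_factor hQ.posSemidef
  obtain ⟨C, rfl⟩ := aux_posSemidef_factor hW
  have hu : IsUnit B.det := by
    have := hQ.det_pos.ne'
    rw [det_mul, det_transpose] at this
    exact isUnit_iff_ne_zero.2 fun h => this (by simp [h])
  rw [aux_quad_gram_one, aux_quad_gram_one]
  have h1 := aux_frob (C * B⁻¹) (B *ᵥ x)
  rw [mulVec_mulVec, mul_assoc, nonsing_inv_mul B hu, mul_one] at h1
  convert h1 using 2
  rw [Matrix.mul_inv_rev, transpose_mul, ← transpose_nonsing_inv, mul_assoc, trace_mul_comm]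
  simp only [mul_assoc]

/-- First order optimality of a determinant maximiser along a segment. -/
lemma aux_det_opt {n : ℕ} {Q W : Matrix (Fin n) (Fin n) ℝ} (hQ : Q.PosDef)
    (h : ∀ s : ℝ, 0 < s → s < 1 → (Q + s • (W - Q)).det ≤ Q.det) :
    (Q⁻¹ * W).trace ≤ n := by
  have hu : IsUnit Q.det := hQ.isUnit.map detMonoidHom
  set M := Q⁻¹ * W - 1 with hM
  have htr : M.trace = (Q⁻¹ * W).trace - n := by simp [hM]
  have key : ∀ s : ℝ, 0 < s → s < 1 → M.trace +
      (det (1 + (Polynomial.X : Polynomial ℝ) • M.map Polynomial.C)).divX.divX.eval s * s ≤ 0 := by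
    intro s h0 h1
    have h2 : Q + s • (W - Q) = Q * (1 + s • M) := by
      rw [hM, mul_add, mul_one, Matrix.mul_smul, mul_sub, ← mul_assoc, mul_nonsing_inv Q hu, one_mul,
        mul_one]
    have h3 := h s h0 h1
    rw [h2, det_mul, det_one_add_smul] at h3
    have h4 := hQ.det_pos
    have h5 := le_of_mul_le_mul_left (h3.trans_eq (mul_one _).symm) h4
    refine le_of_mul_le_mul_right (a := s) ?_ h0
    linarith
  have hlim : Tendsto (fun s : ℝ => M.trace +
      (det (1 + (Polynomial.X : Polynomial ℝ) • M.map Polynomial.C)).divX.divX.eval s * s)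
      (nhdsWithin 0 (Set.Ioi 0)) (nhds (M.trace)) := by
    refine Tendsto.mono_left ?_ nhdsWithin_le_nhds
    refine Continuous.tendsto' ?_ _ _ (by simp)
    have := Polynomial.continuous
      (det (1 + (Polynomial.X : Polynomial ℝ) • M.map Polynomial.C)).divX.divX
    fun_prop
  have := le_of_tendsto hlim (b := 0) (by
    filter_upwards [Ioo_mem_nhdsGT (zero_lt_one' ℝ)] with s hs
    exact key s hs.1 hs.2)
  linarith

/-- The symmetric matrices squeezed between `0` and `f` as quadratic forms. -/
def auxK {n : ℕ} (f : (Fin n → ℝ) → ℝ) : Set (Matrix (Fin n) (Fin n) ℝ) :=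
  {Q | Qᵀ = Q ∧ ∀ x, 0 ≤ x ⬝ᵥ Q *ᵥ x ∧ x ⬝ᵥ Q *ᵥ x ≤ f x}

lemma auxK_posSemidef {n : ℕ} {f : (Fin n → ℝ) → ℝ} {Q : Matrix (Fin n) (Fin n) ℝ}
    (h : Q ∈ auxK f) : Q.PosSemidef := by
  refine .of_dotProduct_mulVec_nonneg ?_ fun x => ?_
  · rw [IsHermitian, conjTranspose_eq_transpose_of_trivial]; exact h.1
  · simpa using (h.2 x).1

lemma auxK_compact {n : ℕ} (f : (Fin n → ℝ) → ℝ) (C : ℝ) (hf : ∀ x, f x ≤ C * (x ⬝ᵥ x)) :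
    IsCompact (auxK f) := by
  have hc : IsCompact (Set.univ.pi fun _ : Fin n => Set.univ.pi fun _ : Fin n => Set.Icc (-C) C) :=
    isCompact_univ_pi fun _ => isCompact_univ_pi fun _ => isCompact_Icc
  refine IsCompact.of_isClosed_subset hc ?_ ?_
  · have : auxK f = {Q | Qᵀ = Q} ∩ ⋂ x, ({Q | 0 ≤ x ⬝ᵥ Q *ᵥ x} ∩ {Q | x ⬝ᵥ Q *ᵥ x ≤ f x}) := by
      ext Q; simp [auxK]
    change IsClosed (auxK f : Set (Matrix (Fin n) (Fin n) ℝ))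
    rw [this]
    have hq : ∀ x : Fin n → ℝ, Continuous fun Q : Matrix (Fin n) (Fin n) ℝ => x ⬝ᵥ Q *ᵥ x :=
      fun x => by fun_prop
    refine (isClosed_eq (by fun_prop) continuous_id).inter (isClosed_iInter fun x => ?_)
    exact (isClosed_le continuous_const (hq x)).inter (isClosed_le (hq x) continuous_const)
  · intro Q hQ i _ j _
    have hd : ∀ k, Q k k ≤ C := fun k => by
      have := ((hQ.2 (Pi.single k 1)).2).trans (hf _)
      simpa using this
    have hs : Q j i = Q i j := congrFun (congrFun hQ.1 i) j
    have h1 := (hQ.2 (Pi.single i 1 + Pi.single j 1)).1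
    have h2 := (hQ.2 (Pi.single i 1 - Pi.single j 1)).1
    simp [mulVec_add, mulVec_sub] at h1 h2
    have := hd i
    have := hd j
    constructor <;> linarith

lemma auxK_max {n : ℕ} (f : (Fin n → ℝ) → ℝ) (C : ℝ) (hf : ∀ x, f x ≤ C * (x ⬝ᵥ x))
    (hf' : ∀ x, x ⬝ᵥ x ≤ f x) :
    ∃ Q ∈ auxK f, Q.PosDef ∧ ∀ W ∈ auxK f, ∀ x, x ⬝ᵥ W *ᵥ x ≤ n * (x ⬝ᵥ Q *ᵥ x) := by
  have h1 : (1 : Matrix (Fin n) (Fin n) ℝ) ∈ auxK f :=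
    ⟨by simp, fun x => by simpa using ⟨aux_dot_nonneg x, hf' x⟩⟩
  obtain ⟨Q, hQ, hmax⟩ := (auxK_compact f C hf).exists_isMaxOn ⟨1, h1⟩
    (f := fun Q => Q.det) (Continuous.continuousOn (by fun_prop))
  have hdet : 1 ≤ Q.det := by simpa using hmax h1
  have hpd : Q.PosDef := (auxK_posSemidef hQ).posDef_iff_det_ne_zero.2 (by linarith)
  refine ⟨Q, hQ, hpd, fun W hW x => ?_⟩
  refine (aux_trace_le hpd (auxK_posSemidef hW) x).trans
    (mul_le_mul_of_nonneg_right ?_ (hQ.2 x).1)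
  refine aux_det_opt hpd fun s h0 h1 => hmax ?_
  refine ⟨by simp [hQ.1, hW.1], fun x => ?_⟩
  have e : x ⬝ᵥ (Q + s • (W - Q)) *ᵥ x = (1 - s) * (x ⬝ᵥ Q *ᵥ x) + s * (x ⬝ᵥ W *ᵥ x) := by
    simp [add_mulVec, sub_mulVec, smul_mulVec]
    ring
  rw [e]
  obtain ⟨a1, a2⟩ := hQ.2 x
  obtain ⟨b1, b2⟩ := hW.2 x
  constructor <;> nlinarith

lemma aux_pathProd_succ {n N : ℕ} (A : Fin N → Matrix (Fin n) (Fin n) ℝ) (t : ℕ)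
    (σ : Fin (t + 1) → Fin N) :
    pathProd A (t + 1) σ = pathProd A t (fun i => σ i.succ) * A (σ 0) := by
  simp [pathProd, List.ofFn_succ]

lemma aux_pathProd_zero {n N : ℕ} (A : Fin N → Matrix (Fin n) (Fin n) ℝ) (σ : Fin 0 → Fin N) :
    pathProd A 0 σ = 1 := by
  simp [pathProd]

/-- A common bound, at least one, for the norms of the matrices. -/
lemma aux_exists_b {n N : ℕ} (A : Fin N → Matrix (Fin n) (Fin n) ℝ) :
    ∃ b : ℝ, 1 ≤ b ∧ ∀ k, euclOpNorm (A k) ≤ b := by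
  refine ⟨1 + ∑ k, euclOpNorm (A k), ?_, fun k => ?_⟩
  · have := Finset.sum_nonneg fun k (_ : k ∈ Finset.univ) => aux_opNorm_nonneg (A k)
    linarith
  · have := Finset.single_le_sum (f := fun k => euclOpNorm (A k))
      (fun k _ => aux_opNorm_nonneg (A k)) (Finset.mem_univ k)
    linarith

lemma aux_pathProd_le {n N : ℕ} (A : Fin N → Matrix (Fin n) (Fin n) ℝ) (b : ℝ) (hb : 1 ≤ b)
    (hA : ∀ k, euclOpNorm (A k) ≤ b) (t : ℕ) (σ : Fin t → Fin N) :
    euclOpNorm (pathProd A t σ) ≤ b ^ t := by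
  induction t with
  | zero => simpa [aux_pathProd_zero] using aux_opNorm_one
  | succ t ih =>
    rw [aux_pathProd_succ, pow_succ]
    exact (aux_opNorm_mul _ _).trans
      (mul_le_mul (ih _) (hA _) (aux_opNorm_nonneg _) (by positivity))

lemma aux_root_le {x c : ℝ} (hx : 0 ≤ x) (hc : 0 ≤ c) {t : ℕ} (ht : t ≠ 0) (h : x ≤ c ^ t) :
    x ^ (1 / (t : ℝ)) ≤ c := by
  have := Real.rpow_le_rpow hx h (z := 1 / (t : ℝ)) (by positivity)
  rwa [one_div, Real.pow_rpow_inv_natCast hc ht, ← one_div] at this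

lemma aux_root_bound {n N : ℕ} (A : Fin N → Matrix (Fin n) (Fin n) ℝ) (b : ℝ) (hb : 1 ≤ b)
    (hA : ∀ k, euclOpNorm (A k) ≤ b) (t : ℕ) (σ : Fin t → Fin N) :
    euclOpNorm (pathProd A t σ) ^ (1 / (t : ℝ)) ≤ b := by
  rcases eq_or_ne t 0 with rfl | ht
  · simpa using hb
  · exact aux_root_le (aux_opNorm_nonneg _) (by linarith) ht (aux_pathProd_le A b hb hA t σ)

/-- The sequence whose limsup is the constrained joint spectral radius. -/
noncomputable def auxU {V : Type} {n N : ℕ} (E : Set (V × V × Fin N))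
    (A : Fin N → Matrix (Fin n) (Fin n) ℝ) (t : ℕ) : ℝ :=
  sSup { x : ℝ | ∃ (v : Fin (t + 1) → V) (σ : Fin t → Fin N),
      IsPath E v σ ∧ x = euclOpNorm (pathProd A t σ) ^ (1 / (t : ℝ)) }

lemma auxU_nonneg {V : Type} {n N : ℕ} (E : Set (V × V × Fin N))
    (A : Fin N → Matrix (Fin n) (Fin n) ℝ) (t : ℕ) : 0 ≤ auxU E A t := by
  refine Real.sSup_nonneg ?_
  rintro _ ⟨v, σ, -, rfl⟩
  exact Real.rpow_nonneg (aux_opNorm_nonneg _) _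

lemma auxU_bounded {V : Type} {n N : ℕ} (E : Set (V × V × Fin N))
    (A : Fin N → Matrix (Fin n) (Fin n) ℝ) :
    atTop.IsBoundedUnder (· ≤ ·) (auxU E A) := by
  obtain ⟨b, hb, hA⟩ := aux_exists_b A
  refine isBoundedUnder_of ⟨b, fun t => Real.sSup_le ?_ (by linarith)⟩
  rintro _ ⟨v, σ, -, rfl⟩
  exact aux_root_bound A b hb hA t σ

lemma aux_le_auxU {V : Type} {n N : ℕ} (E : Set (V × V × Fin N))
    (A : Fin N → Matrix (Fin n) (Fin n) ℝ) (t : ℕ) (v : Fin (t + 1) → V) (σ : Fin t → Fin N)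
    (h : IsPath E v σ) : euclOpNorm (pathProd A t σ) ^ (1 / (t : ℝ)) ≤ auxU E A t := by
  obtain ⟨b, hb, hA⟩ := aux_exists_b A
  refine le_csSup ⟨b, ?_⟩ ⟨v, σ, h, rfl⟩
  rintro _ ⟨v, σ, -, rfl⟩
  exact aux_root_bound A b hb hA t σ

lemma aux_cjsr_nonneg {V : Type} {n N : ℕ} (E : Set (V × V × Fin N))
    (A : Fin N → Matrix (Fin n) (Fin n) ℝ) : 0 ≤ cjsr E A :=
  le_limsup_of_frequently_le (u := auxU E A)
    (Eventually.of_forall fun t => auxU_nonneg E A t).frequently (auxU_bounded E A)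

/-- Uniform equivalence of a positive definite form with the Euclidean one. -/
lemma aux_posDef_bounds {n : ℕ} {Q : Matrix (Fin n) (Fin n) ℝ} (hQ : Q.PosDef) :
    ∃ c : ℝ, 0 ≤ c ∧ ∀ x, x ⬝ᵥ x ≤ c * (x ⬝ᵥ Q *ᵥ x) ∧ x ⬝ᵥ Q *ᵥ x ≤ c * (x ⬝ᵥ x) := by
  obtain ⟨B, rfl⟩ := aux_posSemidef_factor hQ.posSemidef
  have hu : IsUnit B.det := by
    have := hQ.det_pos.ne'
    rw [det_mul, det_transpose] at this
    exact isUnit_iff_ne_zero.2 fun h => this (by simp [h])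
  refine ⟨euclOpNorm B⁻¹ ^ 2 + euclOpNorm B ^ 2, by positivity, fun x => ?_⟩
  rw [aux_quad_gram_one]
  have h1 := aux_opNorm_bound B x
  have h2 := aux_opNorm_bound B⁻¹ (B *ᵥ x)
  rw [mulVec_mulVec, nonsing_inv_mul B hu, one_mulVec] at h2
  have h3 := mul_nonneg (sq_nonneg (euclOpNorm B)) (aux_dot_nonneg (B *ᵥ x))
  have h4 := mul_nonneg (sq_nonneg (euclOpNorm B⁻¹)) (aux_dot_nonneg x)
  constructor <;> linarith

lemma aux_path_decrease {V : Type} {n N : ℕ} (E : Set (V × V × Fin N))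
    (A : Fin N → Matrix (Fin n) (Fin n) ℝ) (γ : ℝ) (Q : V → Matrix (Fin n) (Fin n) ℝ)
    (h : ∀ vi vj : V, ∀ σ : Fin N, (vi, vj, σ) ∈ E → ∀ x : Fin n → ℝ,
      (A σ *ᵥ x) ⬝ᵥ Q vj *ᵥ (A σ *ᵥ x) ≤ γ ^ 2 * (x ⬝ᵥ Q vi *ᵥ x))
    (t : ℕ) (v : Fin (t + 1) → V) (σ : Fin t → Fin N) (hp : IsPath E v σ) (x : Fin n → ℝ) :
    (pathProd A t σ *ᵥ x) ⬝ᵥ Q (v (Fin.last t)) *ᵥ (pathProd A t σ *ᵥ x) ≤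
      (γ ^ 2) ^ t * (x ⬝ᵥ Q (v 0) *ᵥ x) := by
  induction t generalizing x with
  | zero => simp [aux_pathProd_zero]
  | succ t ih =>
    have h1 := ih (fun i => v i.succ) (fun i => σ i.succ) (fun i => hp i.succ) (A (σ 0) *ᵥ x)
    have h2 := h _ _ _ (hp 0) x
    rw [aux_pathProd_succ, ← mulVec_mulVec]
    refine h1.trans ?_
    rw [pow_succ (γ ^ 2), mul_assoc]
    exact mul_le_mul_of_nonneg_left h2 (by positivity)

lemma aux_quad_sub {n : ℕ} (c : ℝ) (B Q R : Matrix (Fin n) (Fin n) ℝ) (x : Fin n → ℝ) :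
    x ⬝ᵥ (c • Q - Bᵀ * R * B) *ᵥ x =
      c * (x ⬝ᵥ Q *ᵥ x) - (B *ᵥ x) ⬝ᵥ R *ᵥ (B *ᵥ x) := by
  rw [sub_mulVec, dotProduct_sub, aux_quad_gram, smul_mulVec, dotProduct_smul, smul_eq_mul]

/-- Lower bound: every feasible value bounds the constrained joint spectral radius. -/
lemma aux_lower {V : Type} [Fintype V] {n N : ℕ} (E : Set (V × V × Fin N))
    (A : Fin N → Matrix (Fin n) (Fin n) ℝ) (γ : ℝ) (hγ : 0 < γ)
    (Q : V → Matrix (Fin n) (Fin n) ℝ) (hQ : ∀ u, (Q u).PosDef)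
    (h : ∀ vi vj : V, ∀ σ : Fin N, (vi, vj, σ) ∈ E →
      (γ ^ 2 • Q vi - (A σ)ᵀ * Q vj * A σ).PosDef) : cjsr E A ≤ γ := by
  have hdec : ∀ vi vj : V, ∀ σ : Fin N, (vi, vj, σ) ∈ E → ∀ x : Fin n → ℝ,
      (A σ *ᵥ x) ⬝ᵥ Q vj *ᵥ (A σ *ᵥ x) ≤ γ ^ 2 * (x ⬝ᵥ Q vi *ᵥ x) := by
    intro vi vj σ he x
    have := (h vi vj σ he).posSemidef.dotProduct_mulVec_nonneg x
    rw [star_trivial, aux_quad_sub] at this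
    linarith
  choose c hc0 hc using fun u => aux_posDef_bounds (hQ u)
  set D : ℝ := 1 + ∑ u, c u with hD
  have hcD : ∀ u, c u ≤ D := fun u => by
    have := Finset.single_le_sum (f := c) (fun k _ => hc0 k) (Finset.mem_univ u)
    linarith
  have hD1 : 1 ≤ D := by
    have := Finset.sum_nonneg fun k (_ : k ∈ Finset.univ) => hc0 k
    linarith
  have hnorm : ∀ (t : ℕ) (v : Fin (t + 1) → V) (σ : Fin t → Fin N), IsPath E v σ →
      euclOpNorm (pathProd A t σ) ≤ D * γ ^ t := by
    intro t v σ hp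
    refine aux_opNorm_le _ _ (by positivity) fun x => ?_
    have h1 := aux_path_decrease E A γ Q hdec t v σ hp x
    have h2 := (hc (v (Fin.last t)) (pathProd A t σ *ᵥ x)).1
    have h3 := (hc (v 0) x).2
    have h4 := (hQ (v (Fin.last t))).posSemidef.dotProduct_mulVec_nonneg (pathProd A t σ *ᵥ x)
    rw [star_trivial] at h4
    calc _ ≤ _ := h2
      _ ≤ D * ((pathProd A t σ *ᵥ x) ⬝ᵥ Q (v (Fin.last t)) *ᵥ (pathProd A t σ *ᵥ x)) :=
        mul_le_mul_of_nonneg_right (hcD _) h4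
      _ ≤ D * ((γ ^ 2) ^ t * (x ⬝ᵥ Q (v 0) *ᵥ x)) := by gcongr
      _ ≤ D * ((γ ^ 2) ^ t * (c (v 0) * (x ⬝ᵥ x))) := by gcongr
      _ ≤ D * ((γ ^ 2) ^ t * (D * (x ⬝ᵥ x))) := by
        have := aux_dot_nonneg x
        have := hcD (v 0)
        gcongr
      _ = _ := by rw [← pow_mul, mul_comm 2 t, pow_mul]; ring
  have hlim : Tendsto (fun t : ℕ => D ^ (1 / (t : ℝ)) * γ) atTop (nhds γ) := by
    have h0 : Tendsto (fun t : ℕ => 1 / (t : ℝ)) atTop (nhds 0) := tendsto_one_div_atTop_nhds_zero_nat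
    have := ((Real.continuousAt_const_rpow (a := D) (b := 0) (by linarith)).tendsto.comp h0).mul_const γ
    simpa using this
  have hle : auxU E A ≤ᶠ[atTop] fun t : ℕ => D ^ (1 / (t : ℝ)) * γ := by
    filter_upwards [eventually_ne_atTop 0] with t ht
    refine Real.sSup_le ?_ (by positivity)
    rintro _ ⟨v, σ, hp, rfl⟩
    refine (Real.rpow_le_rpow (aux_opNorm_nonneg _) (hnorm t v σ hp) (by positivity)).trans_eq ?_
    rw [Real.mul_rpow (by positivity) (by positivity), one_div,
      Real.pow_rpow_inv_natCast hγ.le ht]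
  have hco : atTop.IsCoboundedUnder (· ≤ ·) (auxU E A) :=
    (isBoundedUnder_of ⟨0, fun t => auxU_nonneg E A t⟩ :
      atTop.IsBoundedUnder (· ≥ ·) (auxU E A)).isCoboundedUnder_le
  have := limsup_le_limsup hle hco hlim.isBoundedUnder_le
  rw [hlim.limsup_eq] at this
  exact this

/-- `auxR E A v t P`: the matrix `P` is the product along a path of length `t` from `v`. -/
inductive auxR {V : Type} {n N : ℕ} (E : Set (V × V × Fin N))
    (A : Fin N → Matrix (Fin n) (Fin n) ℝ) : V → ℕ → Matrix (Fin n) (Fin n) ℝ → Prop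
  | nil (v : V) : auxR E A v 0 1
  | cons (v w : V) (k : Fin N) (t : ℕ) (P : Matrix (Fin n) (Fin n) ℝ) (he : (v, w, k) ∈ E)
      (h : auxR E A w t P) : auxR E A v (t + 1) (P * A k)

lemma auxR_path {V : Type} {n N : ℕ} {E : Set (V × V × Fin N)}
    {A : Fin N → Matrix (Fin n) (Fin n) ℝ} {u : V} {t : ℕ} {P : Matrix (Fin n) (Fin n) ℝ}
    (h : auxR E A u t P) : ∃ (v : Fin (t + 1) → V) (σ : Fin t → Fin N),
      IsPath E v σ ∧ v 0 = u ∧ P = pathProd A t σ := by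
  induction h with
  | nil v => exact ⟨fun _ => v, Fin.elim0, fun i => i.elim0, rfl, (aux_pathProd_zero A _).symm⟩
  | cons v w k t P he _ ih =>
    obtain ⟨p, σ, hp, h0, rfl⟩ := ih
    refine ⟨Fin.cons v p, Fin.cons k σ, ?_, rfl, ?_⟩
    · intro i
      refine Fin.cases ?_ (fun j => ?_) i
      · simpa [h0] using he
      · have := hp j
        rw [← Fin.succ_castSucc]
        simpa using this
    · simp [aux_pathProd_succ]

lemma auxR_bound {V : Type} {n N : ℕ} (E : Set (V × V × Fin N))
    (A : Fin N → Matrix (Fin n) (Fin n) ℝ) (γ : ℝ) (hγ : cjsr E A < γ) :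
    ∃ C : ℝ, 0 ≤ C ∧ ∀ u t P, auxR E A u t P → euclOpNorm P ≤ C * γ ^ t := by
  have h0 : 0 < γ := (aux_cjsr_nonneg E A).trans_lt hγ
  obtain ⟨b, hb, hA⟩ := aux_exists_b A
  have hev : ∀ᶠ t in atTop, auxU E A t < γ :=
    eventually_lt_of_limsup_lt hγ (auxU_bounded E A)
  obtain ⟨T, hT⟩ := eventually_atTop.1 hev
  set m := max 1 (b / γ) with hm
  have hm1 : 1 ≤ m := le_max_left _ _
  refine ⟨m ^ (T + 1), by positivity, fun u t P hP => ?_⟩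
  obtain ⟨v, σ, hp, -, rfl⟩ := auxR_path hP
  rcases le_or_gt t T with htT | htT
  · have hbm : b ≤ m * γ := by
      have := le_max_right 1 (b / γ)
      rwa [div_le_iff₀ h0] at this
    calc _ ≤ b ^ t := aux_pathProd_le A b hb hA t σ
      _ ≤ (m * γ) ^ t := by gcongr
      _ = m ^ t * γ ^ t := mul_pow _ _ _
      _ ≤ m ^ (T + 1) * γ ^ t := by gcongr; omega
  · have h1 := (aux_le_auxU E A t v σ hp).trans (hT t htT.le).le
    have h2 := pow_le_pow_left₀ (Real.rpow_nonneg (aux_opNorm_nonneg _) _) h1 t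
    rw [one_div, Real.rpow_inv_natCast_pow (aux_opNorm_nonneg _) (by omega)] at h2
    refine h2.trans (le_mul_of_one_le_left (by positivity) (one_le_pow₀ hm1))

/-- The square of the extremal multinorm. -/
noncomputable def auxF {V : Type} {n N : ℕ} (E : Set (V × V × Fin N))
    (A : Fin N → Matrix (Fin n) (Fin n) ℝ) (γ : ℝ) (u : V) (x : Fin n → ℝ) : ℝ :=
  sSup {r : ℝ | ∃ t P, auxR E A u t P ∧ r = ((P *ᵥ x) ⬝ᵥ (P *ᵥ x)) / (γ ^ 2) ^ t}

/-- Upper bound: a feasible family of quadratic forms. -/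
lemma aux_upper {V : Type} {n N : ℕ} (E : Set (V × V × Fin N))
    (A : Fin N → Matrix (Fin n) (Fin n) ℝ) (γ : ℝ) (hγ : cjsr E A < γ) :
    ∃ Q : V → Matrix (Fin n) (Fin n) ℝ, (∀ u, (Q u).PosDef) ∧
      ∀ vi vj : V, ∀ σ : Fin N, (vi, vj, σ) ∈ E → ∀ x : Fin n → ℝ,
        (A σ *ᵥ x) ⬝ᵥ Q vj *ᵥ (A σ *ᵥ x) ≤ n * γ ^ 2 * (x ⬝ᵥ Q vi *ᵥ x) := by
  have h0 : 0 < γ := (aux_cjsr_nonneg E A).trans_lt hγ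
  obtain ⟨C, hC0, hC⟩ := auxR_bound E A γ hγ
  have hbd : ∀ u t P, auxR E A u t P → ∀ x,
      ((P *ᵥ x) ⬝ᵥ (P *ᵥ x)) / (γ ^ 2) ^ t ≤ C ^ 2 * (x ⬝ᵥ x) := by
    intro u t P hP x
    rw [div_le_iff₀ (by positivity)]
    have h1 := pow_le_pow_left₀ (aux_opNorm_nonneg _) (hC u t P hP) 2
    refine (aux_opNorm_bound P x).trans
      ((mul_le_mul_of_nonneg_right h1 (aux_dot_nonneg x)).trans_eq ?_)
    rw [← pow_mul, mul_comm 2 t, pow_mul]; ring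
  have hle : ∀ u t P, auxR E A u t P → ∀ x,
      ((P *ᵥ x) ⬝ᵥ (P *ᵥ x)) / (γ ^ 2) ^ t ≤ auxF E A γ u x := by
    intro u t P hP x
    refine le_csSup ⟨C ^ 2 * (x ⬝ᵥ x), ?_⟩ ⟨t, P, hP, rfl⟩
    rintro _ ⟨t, P, hP, rfl⟩
    exact hbd u t P hP x
  have hF1 : ∀ u x, auxF E A γ u x ≤ C ^ 2 * (x ⬝ᵥ x) := by
    intro u x
    refine Real.sSup_le ?_ (mul_nonneg (by positivity) (aux_dot_nonneg x))
    rintro _ ⟨t, P, hP, rfl⟩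
    exact hbd u t P hP x
  have hF2 : ∀ u x, x ⬝ᵥ x ≤ auxF E A γ u x := by
    intro u x
    simpa using hle u 0 1 (auxR.nil u) x
  have hF3 : ∀ vi vj : V, ∀ σ : Fin N, (vi, vj, σ) ∈ E → ∀ x : Fin n → ℝ,
      auxF E A γ vj (A σ *ᵥ x) ≤ γ ^ 2 * auxF E A γ vi x := by
    intro vi vj σ he x
    refine Real.sSup_le ?_
      (mul_nonneg (by positivity) ((aux_dot_nonneg x).trans (hF2 vi x)))
    rintro _ ⟨t, P, hP, rfl⟩
    have h1 := hle vi (t + 1) (P * A σ) (auxR.cons vi vj σ t P he hP) x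
    rw [← mulVec_mulVec, pow_succ, div_le_iff₀ (by positivity)] at h1
    rw [div_le_iff₀ (by positivity)]
    linarith
  choose Q hQK hQ hmax using fun u => auxK_max (auxF E A γ u) (C ^ 2) (hF1 u) (hF2 u)
  refine ⟨Q, hQ, fun vi vj σ he x => ?_⟩
  have hW : (γ ^ 2)⁻¹ • ((A σ)ᵀ * Q vj * A σ) ∈ auxK (auxF E A γ vi) := by
    refine ⟨?_, fun y => ?_⟩
    · simp [transpose_mul, (hQK vj).1, mul_assoc]
    · rw [smul_mulVec, dotProduct_smul, aux_quad_gram, smul_eq_mul]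
      obtain ⟨a1, a2⟩ := (hQK vj).2 (A σ *ᵥ y)
      refine ⟨by positivity, ?_⟩
      rw [inv_mul_le_iff₀ (by positivity)]
      exact a2.trans (hF3 vi vj σ he y)
  have h1 := hmax vi _ hW x
  rw [smul_mulVec, dotProduct_smul, aux_quad_gram, smul_eq_mul,
    inv_mul_le_iff₀ (by positivity)] at h1
  linarith

/-- `ρ̂(G, M) ≤ γ*(G, M) ≤ √n ρ̂(G, M)`. -/
theorem gammaStar_bounds {n N : ℕ} (hn : 1 ≤ n) (hN : 1 ≤ N)
    {V : Type} [Fintype V] [Nonempty V]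
    (E : Set (V × V × Fin N)) (A : Fin N → Matrix (Fin n) (Fin n) ℝ)
    (hconn : StronglyConnected E) :
    cjsr E A ≤ gammaStar E A ∧ gammaStar E A ≤ Real.sqrt n * cjsr E A := by
  have hn' : (1 : ℝ) ≤ n := by exact_mod_cast hn
  have hs : 0 < Real.sqrt n := Real.sqrt_pos.2 (by linarith)
  have hfeas : ∀ c : ℝ, Real.sqrt n * cjsr E A < c →
      c ∈ {γ : ℝ | 0 < γ ∧ ∃ Q : V → Matrix (Fin n) (Fin n) ℝ,
        (∀ u : V, (Q u).PosDef) ∧ ∀ vi vj : V, ∀ σ : Fin N, (vi, vj, σ) ∈ E →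
          (γ ^ 2 • Q vi - (A σ)ᵀ * Q vj * A σ).PosDef} := by
    intro c hc
    have hc0 : 0 < c := (mul_nonneg hs.le (aux_cjsr_nonneg E A)).trans_lt hc
    have hc1 : cjsr E A < c / Real.sqrt n := by rwa [lt_div_iff₀ hs, mul_comm]
    obtain ⟨γ, hγ1, hγ2⟩ := exists_between hc1
    have hγ0 : 0 < γ := (aux_cjsr_nonneg E A).trans_lt hγ1
    rw [lt_div_iff₀ hs] at hγ2
    have hsq : n * γ ^ 2 < c ^ 2 := by
      have := pow_lt_pow_left₀ hγ2 (by positivity) two_ne_zero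
      rw [mul_pow, Real.sq_sqrt (by linarith)] at this
      linarith
    obtain ⟨Q, hQ, h⟩ := aux_upper E A γ hγ1
    refine ⟨hc0, Q, hQ, fun vi vj σ he => ?_⟩
    have hherm : ∀ u, (Q u)ᵀ = Q u := fun u => by
      have := (hQ u).isHermitian
      rwa [IsHermitian, conjTranspose_eq_transpose_of_trivial] at this
    refine .of_dotProduct_mulVec_pos ?_ fun x hx => ?_
    · rw [IsHermitian, conjTranspose_eq_transpose_of_trivial]
      simp [transpose_mul, hherm, mul_assoc]
    · have h1 := (hQ vi).dotProduct_mulVec_pos hx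
      have h2 := h vi vj σ he x
      rw [star_trivial] at h1 ⊢
      rw [aux_quad_sub]
      have h3 := mul_lt_mul_of_pos_right hsq h1
      linarith
  constructor
  · refine le_csInf ⟨_, hfeas (Real.sqrt n * cjsr E A + 1) (by linarith)⟩ ?_
    rintro γ ⟨hγ, Q, hQ, h⟩
    exact aux_lower E A γ hγ Q hQ h
  · refine le_of_forall_gt_imp_ge_of_dense fun c hc => ?_
    exact csInf_le ⟨0, fun γ h => h.1.le⟩ (hfeas c hc)
end

section
/- For every integer T ≥ 1, the CJSR of the lifted system S(G_T, M^T) equals the T-th power of the CJSR of S(G, M): ρ̂(G_T, M^T) = ρ̂(G, M)^T. -/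
open Filter Matrix

theorem sSup_rpow_aux {ι κ : Type*} [Finite ι] [Finite κ] (P : ι → κ → Prop) (f : κ → ℝ)
    (hf : ∀ k, 0 ≤ f k) (p : ℝ) (hp : 0 < p) :
    sSup {x : ℝ | ∃ i k, P i k ∧ x = f k ^ p} = (sSup {x : ℝ | ∃ i k, P i k ∧ x = f k}) ^ p := by
  have b1 : BddAbove {x : ℝ | ∃ i k, P i k ∧ x = f k ^ p} := by
    refine (Set.finite_range (fun k => f k ^ p)).bddAbove.mono ?_
    rintro x ⟨i, k, _, rfl⟩
    exact ⟨k, rfl⟩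
  have b2 : BddAbove {x : ℝ | ∃ i k, P i k ∧ x = f k} := by
    refine (Set.finite_range f).bddAbove.mono ?_
    rintro x ⟨i, k, _, rfl⟩
    exact ⟨k, rfl⟩
  have n1 : 0 ≤ sSup {x : ℝ | ∃ i k, P i k ∧ x = f k ^ p} := by
    apply Real.sSup_nonneg
    rintro x ⟨i, k, _, rfl⟩
    exact Real.rpow_nonneg (hf k) _
  have n2 : 0 ≤ sSup {x : ℝ | ∃ i k, P i k ∧ x = f k} := by
    apply Real.sSup_nonneg
    rintro x ⟨i, k, _, rfl⟩
    exact hf k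
  apply le_antisymm
  · apply Real.sSup_le _ (Real.rpow_nonneg n2 _)
    rintro x ⟨i, k, h, rfl⟩
    exact Real.rpow_le_rpow (hf k) (le_csSup b2 ⟨i, k, h, rfl⟩) hp.le
  · have key : sSup {x : ℝ | ∃ i k, P i k ∧ x = f k} ≤
        (sSup {x : ℝ | ∃ i k, P i k ∧ x = f k ^ p}) ^ (p⁻¹) := by
      apply Real.sSup_le _ (Real.rpow_nonneg n1 _)
      rintro x ⟨i, k, h, rfl⟩
      rw [Real.le_rpow_inv_iff_of_pos (hf k) n1 hp]
      exact le_csSup b1 ⟨i, k, h, rfl⟩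
    rwa [Real.le_rpow_inv_iff_of_pos n2 n1 hp] at key

/-- The maximal norm over paths of length `t`. -/
noncomputable def maxNorm {V : Type*} {n N : ℕ} (E : Set (V × V × Fin N))
    (A : Fin N → Matrix (Fin n) (Fin n) ℝ) (t : ℕ) : ℝ :=
  sSup { x : ℝ | ∃ (v : Fin (t + 1) → V) (σ : Fin t → Fin N),
      IsPath E v σ ∧ x = euclOpNorm (pathProd A t σ) }

theorem euclOpNorm_nonneg {n : ℕ} (A : Matrix (Fin n) (Fin n) ℝ) : 0 ≤ euclOpNorm A :=
  norm_nonneg _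

theorem euclOpNorm_mul_le {n : ℕ} (A B : Matrix (Fin n) (Fin n) ℝ) :
    euclOpNorm (A * B) ≤ euclOpNorm A * euclOpNorm B := by
  unfold euclOpNorm
  refine le_trans (le_of_eq ?_) (ContinuousLinearMap.opNorm_comp_le _ _)
  congr 1
  ext x i
  simp [Matrix.toLpLin_apply, Matrix.mulVec_mulVec]

theorem maxNorm_nonneg {V : Type*} {n N : ℕ} (E : Set (V × V × Fin N))
    (A : Fin N → Matrix (Fin n) (Fin n) ℝ) (t : ℕ) : 0 ≤ maxNorm E A t := by
  apply Real.sSup_nonneg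
  rintro x ⟨v, σ, _, rfl⟩
  exact euclOpNorm_nonneg _

theorem le_maxNorm {V : Type*} [Finite V] {n N : ℕ} (E : Set (V × V × Fin N))
    (A : Fin N → Matrix (Fin n) (Fin n) ℝ) (t : ℕ) (v : Fin (t + 1) → V) (σ : Fin t → Fin N)
    (h : IsPath E v σ) : euclOpNorm (pathProd A t σ) ≤ maxNorm E A t := by
  refine le_csSup ?_ ⟨v, σ, h, rfl⟩
  refine (Set.finite_range (fun σ : Fin t → Fin N => euclOpNorm (pathProd A t σ))).bddAbove.mono ?_
  rintro x ⟨i, k, _, rfl⟩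
  exact ⟨k, rfl⟩

theorem maxNorm_add_le {V : Type*} [Finite V] {n N : ℕ} (E : Set (V × V × Fin N))
    (A : Fin N → Matrix (Fin n) (Fin n) ℝ) (s t : ℕ) :
    maxNorm E A (s + t) ≤ maxNorm E A s * maxNorm E A t := by
  apply Real.sSup_le _ (mul_nonneg (maxNorm_nonneg _ _ _) (maxNorm_nonneg _ _ _))
  rintro x ⟨v, σ, h, rfl⟩
  have e : pathProd A (s + t) σ = pathProd A t (fun i => σ (Fin.natAdd s i)) *
      pathProd A s (fun i => σ (Fin.castAdd t i)) := by
    simp [pathProd, List.ofFn_add]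
    rfl
  rw [e, mul_comm (maxNorm E A s)]
  refine (euclOpNorm_mul_le _ _).trans (mul_le_mul ?_ ?_ (euclOpNorm_nonneg _)
    (maxNorm_nonneg _ _ _))
  · refine le_maxNorm E A t (fun i => v ⟨s + i, by omega⟩) _ ?_
    intro i
    exact h (Fin.natAdd s i)
  · refine le_maxNorm E A s (fun i => v ⟨i, by omega⟩) _ ?_
    intro i
    exact h (Fin.castAdd t i)

theorem eventually_lt_aux (a : ℕ → ℝ) (h0 : ∀ t, 0 ≤ a t)
    (ha : ∀ s t, a (s + t) ≤ a s * a t) (m : ℕ) (hm : m ≠ 0) (r : ℝ)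
    (h : a m ^ (1 / (m : ℝ)) < r) : ∀ᶠ t in atTop, a t ^ (1 / (t : ℝ)) < r := by
  have hr : 0 < r := lt_of_le_of_lt (Real.rpow_nonneg (h0 m) _) h
  obtain ⟨ε, hε, hεr⟩ := exists_between hr
  have hpos : ∀ t, 0 < max (a t) (ε ^ t) := fun t => lt_max_of_lt_right (pow_pos hε t)
  have hsub : Subadditive (fun t => Real.log (max (a t) (ε ^ t))) := by
    intro s t
    rw [← Real.log_mul (hpos s).ne' (hpos t).ne']
    apply Real.log_le_log (hpos _)
    apply max_le
    · exact (ha s t).trans (mul_le_mul (le_max_left _ _) (le_max_left _ _) (h0 _) (hpos _).le)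
    · rw [pow_add]
      exact mul_le_mul (le_max_right _ _) (le_max_right _ _) (pow_pos hε _).le (hpos _).le
  have conv : ∀ t : ℕ, t ≠ 0 → ∀ x : ℝ, 0 < x → (Real.log x / t < Real.log r ↔ x < r ^ t) := by
    intro t ht x hx
    have : (0 : ℝ) < t := by positivity
    rw [div_lt_iff₀ this, mul_comm, ← Real.log_pow, Real.log_lt_log_iff hx (by positivity)]
  have conv2 : ∀ t : ℕ, t ≠ 0 → (a t ^ (1 / (t : ℝ)) < r ↔ a t < r ^ t) := by
    intro t ht
    have : (0 : ℝ) < t := by positivity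
    rw [one_div, Real.rpow_inv_lt_iff_of_pos (h0 t) hr.le this, Real.rpow_natCast]
  have h1 : Real.log (max (a m) (ε ^ m)) / m < Real.log r := by
    rw [conv m hm _ (hpos m)]
    exact max_lt ((conv2 m hm).1 h) (pow_lt_pow_left₀ hεr hε.le hm)
  filter_upwards [hsub.eventually_div_lt_of_div_lt hm h1, eventually_ne_atTop 0] with t ht ht0
  rw [conv2 t ht0]
  exact lt_of_le_of_lt (le_max_left _ _) ((conv t ht0 _ (hpos t)).1 ht)

theorem exists_tendsto_aux (a : ℕ → ℝ) (h0 : ∀ t, 0 ≤ a t)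
    (ha : ∀ s t, a (s + t) ≤ a s * a t) :
    ∃ L : ℝ, Tendsto (fun t : ℕ => a t ^ (1 / (t : ℝ))) atTop (nhds L) := by
  let S : Set ℝ := (fun t : ℕ => a t ^ (1 / (t : ℝ))) '' {t | t ≠ 0}
  have hb : BddBelow S := ⟨0, by
    rintro x ⟨t, _, rfl⟩
    exact Real.rpow_nonneg (h0 t) _⟩
  have hne : S.Nonempty := ⟨_, 1, one_ne_zero, rfl⟩
  refine ⟨sInf S, tendsto_order.2 ⟨fun r hr => ?_, fun r hr => ?_⟩⟩
  · filter_upwards [eventually_ne_atTop 0] with t ht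
    exact hr.trans_le (csInf_le hb ⟨t, ht, rfl⟩)
  · obtain ⟨x, ⟨m, hm, rfl⟩, hx⟩ := exists_lt_of_csInf_lt hne hr
    exact eventually_lt_aux a h0 ha m hm r hx

/-- `ρ̂(G_T, M^T) = ρ̂(G, M)^T`. -/
theorem cjsrLift_eq_pow {n N : ℕ} (hn : 1 ≤ n) (hN : 1 ≤ N)
    {V : Type} [Fintype V] [Nonempty V]
    (E : Set (V × V × Fin N)) (A : Fin N → Matrix (Fin n) (Fin n) ℝ)
    (hconn : StronglyConnected E) :
    ∀ T : ℕ, 1 ≤ T → cjsrLift E A T = cjsr E A ^ T := by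
  intro T hT
  obtain ⟨L, hL⟩ := exists_tendsto_aux (maxNorm E A) (maxNorm_nonneg E A) (maxNorm_add_le E A)
  have h1 : cjsr E A = L := by
    refine Tendsto.limsup_eq (hL.congr' ?_)
    filter_upwards [eventually_ne_atTop 0] with t ht
    exact (sSup_rpow_aux (fun (v : Fin (t + 1) → V) (σ : Fin t → Fin N) => IsPath E v σ)
      (fun σ => euclOpNorm (pathProd A t σ)) (fun _ => euclOpNorm_nonneg _) _ (by positivity)).symm
  have h2 : cjsrLift E A T = L ^ T := by
    have hk : Tendsto (fun k : ℕ => k * T) atTop atTop :=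
      tendsto_id.atTop_mul_const' (by omega)
    refine Tendsto.limsup_eq (((hL.comp hk).pow T).congr' ?_)
    filter_upwards [eventually_ne_atTop 0] with k hk0
    refine Eq.trans ?_ (sSup_rpow_aux
      (fun (v : Fin (k * T + 1) → V) (σ : Fin (k * T) → Fin N) => IsPath E v σ)
      (fun σ => euclOpNorm (pathProd A (k * T) σ)) (fun _ => euclOpNorm_nonneg _) _
      (by positivity)).symm
    have hT0 : (T : ℝ) ≠ 0 := by positivity
    have hk1 : (k : ℝ) ≠ 0 := by positivity
    change (maxNorm E A (k * T) ^ (1 / ((k * T : ℕ) : ℝ))) ^ T = maxNorm E A (k * T) ^ (1 / (k : ℝ))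
    rw [← Real.rpow_natCast, ← Real.rpow_mul (maxNorm_nonneg _ _ _)]
    congr 1
    push_cast
    field_simp
  rw [h1, h2]
end

section
/- Let T ≥ 1 be an integer. If the lifted system S(G_T, M^T) admits a quadratic Lyapunov multinorm (a family of symmetric positive definite matrices (Q_v)_{v ∈ V} and a constant 0 < γ < 1 with A_eᵀ Q_j A_e ⪯ γ² Q_i in the Loewner order for every edge e of G_T from v_i to v_j with associated matrix A_e), then the system S(G, M) admits a path-dependent Lyapunov function with memory T − 1. -/
open Filter Matrix

/-- Duality: `Bᵀ Y B < X` implies `B X⁻¹ Bᵀ < Y⁻¹` (via the Woodbury identity). -/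
theorem posDef_dual {n : ℕ} {X Y B : Matrix (Fin n) (Fin n) ℝ} (hX : X.PosDef) (hY : Y.PosDef)
    (h : (X - Bᵀ * Y * B).PosDef) : (Y⁻¹ - B * X⁻¹ * Bᵀ).PosDef := by
  obtain ⟨W, hW⟩ : ∃ W, W = X - Bᵀ * Y * B := ⟨_, rfl⟩
  rw [← hW] at h
  have hXu := (Matrix.isUnit_iff_isUnit_det _).1 hX.isUnit
  have hYu := (Matrix.isUnit_iff_isUnit_det _).1 hY.isUnit
  have hWu := (Matrix.isUnit_iff_isUnit_det _).1 h.isUnit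
  have hYt : Yᵀ = Y := by simpa using hY.isHermitian.eq
  have hZ : (Y + (Y * B) * W⁻¹ * (Y * B)ᴴ).PosDef :=
    hY.add_posSemidef (h.inv.posSemidef.mul_mul_conjTranspose_same _)
  have hBB : Bᵀ * Y * B = X - W := by rw [hW]; abel
  have key : (Y⁻¹ - B * X⁻¹ * Bᵀ) * (Y + (Y * B) * W⁻¹ * (Y * B)ᴴ) = 1 := by
    have e1 : (Y * B)ᴴ = Bᵀ * Y := by
      simp [Matrix.conjTranspose_eq_transpose_of_trivial, Matrix.transpose_mul, hYt]
    rw [e1]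
    have a1 : Y⁻¹ * Y = 1 := Matrix.nonsing_inv_mul _ hYu
    have a2 : X⁻¹ * X = 1 := Matrix.nonsing_inv_mul _ hXu
    have a3 : W * W⁻¹ = 1 := Matrix.mul_nonsing_inv _ hWu
    calc (Y⁻¹ - B * X⁻¹ * Bᵀ) * (Y + (Y * B) * W⁻¹ * (Bᵀ * Y))
        = Y⁻¹ * Y + (Y⁻¹ * Y) * B * W⁻¹ * Bᵀ * Y - B * X⁻¹ * Bᵀ * Y
          - B * X⁻¹ * (Bᵀ * Y * B) * W⁻¹ * Bᵀ * Y := by noncomm_ring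
      _ = Y⁻¹ * Y + (Y⁻¹ * Y) * B * W⁻¹ * Bᵀ * Y - B * X⁻¹ * Bᵀ * Y
          - (B * (X⁻¹ * X) * W⁻¹ * Bᵀ * Y - B * X⁻¹ * (W * W⁻¹) * Bᵀ * Y) := by
          rw [hBB]; noncomm_ring
      _ = 1 := by rw [a1, a2, a3]; noncomm_ring
  have hinv := Matrix.inv_eq_left_inv key
  rw [← hinv]
  exact hZ.inv

/-- Sum over all suffixes of a path of the transported dual matrices. -/
noncomputable def sufSum {V : Type} {n N : ℕ} (A : Fin N → Matrix (Fin n) (Fin n) ℝ)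
    (P : V → Matrix (Fin n) (Fin n) ℝ) :
    (m : ℕ) → (Fin (m + 1) → V) → (Fin m → Fin N) → Matrix (Fin n) (Fin n) ℝ
  | 0, v, _ => P (v 0)
  | m + 1, v, σ => P (v (Fin.last (m + 1))) + A (σ (Fin.last m)) *
      sufSum A P m (fun i => v i.castSucc) (fun i => σ i.castSucc) * (A (σ (Fin.last m)))ᵀ

theorem sufSum_posDef {V : Type} {n N : ℕ} (A : Fin N → Matrix (Fin n) (Fin n) ℝ)
    (P : V → Matrix (Fin n) (Fin n) ℝ) (hP : ∀ u, (P u).PosDef) (m : ℕ) :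
    ∀ (v : Fin (m + 1) → V) (σ : Fin m → Fin N), (sufSum A P m v σ).PosDef := by
  induction m with
  | zero => intro v σ; exact hP _
  | succ m ih =>
    intro v σ
    have := (ih (fun i => v i.castSucc) (fun i => σ i.castSucc)).posSemidef.mul_mul_conjTranspose_same
      (A (σ (Fin.last m)))
    rw [Matrix.conjTranspose_eq_transpose_of_trivial] at this
    exact (hP _).add_posSemidef this

theorem pathProd_succ_last {n N : ℕ} (A : Fin N → Matrix (Fin n) (Fin n) ℝ) (t : ℕ)
    (σ : Fin (t + 1) → Fin N) :
    pathProd A (t + 1) σ = A (σ (Fin.last t)) * pathProd A t (fun i => σ i.castSucc) := by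
  unfold pathProd
  rw [List.ofFn_succ_last]
  simp

theorem sufSum_eq {V : Type} {n N : ℕ} (A : Fin N → Matrix (Fin n) (Fin n) ℝ)
    (P : V → Matrix (Fin n) (Fin n) ℝ) (m : ℕ) :
    ∀ (v : Fin (m + 2) → V) (σ : Fin (m + 1) → Fin N),
      sufSum A P (m + 1) v σ = sufSum A P m (fun i => v i.succ) (fun i => σ i.succ) +
        pathProd A (m + 1) σ * P (v 0) * (pathProd A (m + 1) σ)ᵀ := by
  induction m with
  | zero =>
    intro v σ
    simp [sufSum, pathProd]
  | succ m ih =>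
    intro v σ
    rw [sufSum, ih, pathProd_succ_last A (m + 1) σ, sufSum]
    simp only [Fin.succ_last, Fin.succ_castSucc, Matrix.transpose_mul, Fin.castSucc_zero]
    noncomm_ring

/-- a quadratic Lyapunov multinorm for `S(G_T, M^T)` yields a path-dependent
Lyapunov function with memory `T - 1` for `S(G, M)`. -/
theorem exists_pathDepLyap_of_quad_multinorm_lift {n N : ℕ} (hn : 1 ≤ n) (hN : 1 ≤ N)
    {V : Type} [Fintype V] [Nonempty V]
    (E : Set (V × V × Fin N)) (A : Fin N → Matrix (Fin n) (Fin n) ℝ)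
    (hconn : StronglyConnected E)
    (T : ℕ) (hT : 1 ≤ T)
    (γ : ℝ) (hγ0 : 0 < γ) (hγ1 : γ < 1)
    (Q : V → Matrix (Fin n) (Fin n) ℝ)
    (hQ : IsQuadMultinormLift E A T γ Q) :
    ∃ Q' : (Fin (T - 1 + 1) → V) → (Fin (T - 1) → Fin N) → Matrix (Fin n) (Fin n) ℝ,
      IsPathDepLyap E A (T - 1) Q' := by
  obtain ⟨m, rfl⟩ : ∃ m, T = m + 1 := ⟨T - 1, by omega⟩
  obtain ⟨hQp, hQl⟩ := hQ
  have hP : ∀ u, ((Q u)⁻¹).PosDef := fun u => (hQp u).inv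
  refine ⟨fun v σ => (sufSum A (fun u => (Q u)⁻¹) m v σ)⁻¹,
    fun v σ _ => (sufSum_posDef A _ hP m v σ).inv, ?_⟩
  intro v σ hp
  change Fin (m + 2) → V at v
  change Fin (m + 1) → Fin N at σ
  have h1 := hQl v σ hp
  have h2 : (Q (v 0) - (pathProd A (m + 1) σ)ᵀ * Q (v (Fin.last (m + 1))) *
      pathProd A (m + 1) σ).PosDef := by
    have h3 : ((1 - γ ^ 2) • Q (v 0)).PosDef := (hQp _).smul (by nlinarith)
    have h4 := h3.add_posSemidef h1
    convert h4 using 1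
    rw [sub_smul, one_smul]
    abel
  have h5 := posDef_dual (hQp _) (hQp _) h2
  have hS := sufSum_posDef A _ hP m
  have e1 := sufSum_eq A (fun u => (Q u)⁻¹) m v σ
  rw [sufSum] at e1
  have h6 : (sufSum A (fun u => (Q u)⁻¹) m (fun i => v i.succ) (fun i => σ i.succ) -
      A (σ (Fin.last m)) * sufSum A (fun u => (Q u)⁻¹) m (fun i => v i.castSucc)
        (fun i => σ i.castSucc) * (A (σ (Fin.last m)))ᵀ).PosDef := by
    convert h5 using 1
    rw [sub_eq_sub_iff_add_eq_add, add_comm _ (A _ * _ * _), add_comm (A _ * _ * _)]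
    exact e1.symm
  have hS1 := (hS (fun i => v i.castSucc) (fun i => σ i.castSucc))
  have hS2 := (hS (fun i => v i.succ) (fun i => σ i.succ))
  have h7 := posDef_dual (B := (A (σ (Fin.last m)))ᵀ) hS2 hS1 (by simpa using h6)
  simpa using h7
end
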